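/- Let F = Q(a, b) be the field of rational functions in two variables over Q, and regard D, c4, c6 as elements of F. Then F is a finite extension of degree 600 over its subfield Q(c4, c6) generated by c4 and c6, a finite extension of degree 240 over its subfield Q(D, c4), and a finite extension of degree 360 over its subfield Q(D, c6). -/

import Mathlib

set_option linter.unusedSimpArgs false

open MvPolynomial

/-- The field `ℚ(a,b)` of rational functions in two variables over `ℚ`. -/
noncomputable abbrev Fab : Type := FractionRing (MvPolynomial (Fin 2) ℚ)

/-- `D = a*b*(a^10 - 11 a^5 b^5 - b^10)` as an element of `ℚ(a,b)`. -/
noncomputable def DF : Fab :=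
  algebraMap (MvPolynomial (Fin 2) ℚ) Fab
    (X 0 * X 1 * (X 0 ^ 10 - 11 * X 0 ^ 5 * X 1 ^ 5 - X 1 ^ 10))

/-- `c4` as an element of `ℚ(a,b)`. -/
noncomputable def c4F : Fab :=
  algebraMap (MvPolynomial (Fin 2) ℚ) Fab
    (X 0 ^ 20 + 228 * X 0 ^ 15 * X 1 ^ 5 + 494 * X 0 ^ 10 * X 1 ^ 10
      - 228 * X 0 ^ 5 * X 1 ^ 15 + X 1 ^ 20)

/-- `c6` as an element of `ℚ(a,b)`. -/
noncomputable def c6F : Fab :=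
  algebraMap (MvPolynomial (Fin 2) ℚ) Fab
    (-(X 0 ^ 30) + 522 * X 0 ^ 25 * X 1 ^ 5 + 10005 * X 0 ^ 20 * X 1 ^ 10
      + 10005 * X 0 ^ 10 * X 1 ^ 20 - 522 * X 0 ^ 5 * X 1 ^ 25 - X 1 ^ 30)


open IntermediateField in
theorem luroth_relfinrank {K E : Type*} [Field K] [Field E] [Algebra K E] (x y : E)
    (hx : Transcendental K x) (p q : Polynomial K) (hpq : IsCoprime p q) 
    (hq : q ≠ 0) (hy : y = Polynomial.aeval x p / Polynomial.aeval x q) :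
    relfinrank K⟮y⟯ K⟮x⟯ = max p.natDegree q.natDegree := by
  let f : RatFunc K := algebraMap _ _ p / algebraMap _ _ q
  let φ : RatFunc K →ₐ[K] E := K⟮x⟯.val.comp (RatFunc.algEquivOfTranscendental x hx).toAlgHom
  have hφ : ∀ g : Polynomial K, φ (algebraMap _ _ g) = Polynomial.aeval x g := by
    intro g
    simp [φ]
  have hφf : φ f = y := by
    rw [hy, map_div₀, hφ, hφ]
  have h1 : K⟮y⟯ = K⟮f⟯.map φ := by
    rw [adjoin_map, Set.image_singleton, hφf]
  have h2 : K⟮x⟯ = (⊤ : IntermediateField K (RatFunc K)).map φ := by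
    rw [← RatFunc.adjoin_X, adjoin_map, Set.image_singleton, ← RatFunc.algebraMap_X, hφ,
      Polynomial.aeval_X]
  rw [h1, h2, relfinrank_map_map, relfinrank_top_right, RatFunc.finrank_eq_max_natDegree]
  have key : f.num * q = p * f.denom := (RatFunc.num_mul_eq_mul_denom_iff hq).2 rfl
  have cop := RatFunc.isCoprime_num_denom f
  have a1 : Associated f.num p := associated_of_dvd_dvd
    (cop.dvd_of_dvd_mul_right (Dvd.intro _ key)) (hpq.dvd_of_dvd_mul_right (Dvd.intro _ key.symm))
  have a2 : Associated f.denom q := associated_of_dvd_dvd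
    (cop.symm.dvd_of_dvd_mul_left (Dvd.intro_left _ key.symm))
    (hpq.symm.dvd_of_dvd_mul_left (Dvd.intro_left _ key))
  rw [Polynomial.natDegree_eq_of_degree_eq (Polynomial.degree_eq_degree_of_associated a1),
    Polynomial.natDegree_eq_of_degree_eq (Polynomial.degree_eq_degree_of_associated a2)]

open IntermediateField IntermediateField.algebraAdjoinAdjoin in
theorem not_alg_simple (x : Fab) : ¬ Algebra.IsAlgebraic ℚ⟮x⟯ Fab := by
  intro h
  have h' : Algebra.IsAlgebraic (Algebra.adjoin ℚ {x}) Fab :=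
    (IsFractionRing.comap_isAlgebraic_iff (A := Algebra.adjoin ℚ {x}) (K := ℚ⟮x⟯)).2 h
  have h1 := Algebra.IsAlgebraic.trdeg_le_cardinalMk (R := ℚ) (s := {x})
  have h2 : Algebra.trdeg ℚ (MvPolynomial (Fin 2) ℚ) ≤ Algebra.trdeg ℚ Fab :=
    trdeg_le_of_injective (IsScalarTower.toAlgHom ℚ (MvPolynomial (Fin 2) ℚ) Fab)
      (IsFractionRing.injective _ _)
  rw [MvPolynomial.trdeg_of_isDomain] at h2
  have := h2.trans h1
  simp at this

noncomputable def aF : Fab := algebraMap (MvPolynomial (Fin 2) ℚ) Fab (X 0)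
noncomputable def bF : Fab := algebraMap (MvPolynomial (Fin 2) ℚ) Fab (X 1)
noncomputable def tF : Fab := aF / bF

theorem bF_ne : bF ≠ 0 := by
  rw [bF, Ne, IsFractionRing.to_map_eq_zero_iff]
  exact MvPolynomial.X_ne_zero _

theorem top_of_mem (S : Subfield Fab) (ha : tF ∈ S) (hb : bF ∈ S) : S = ⊤ := by
  have ha : aF ∈ S := by
    have := S.mul_mem ha hb
    rwa [tF, div_mul_cancel₀ _ bF_ne] at this
  have hpol : ∀ p : MvPolynomial (Fin 2) ℚ, algebraMap _ Fab p ∈ S := by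
    intro p
    induction p using MvPolynomial.induction_on with
    | C r =>
      have : algebraMap (MvPolynomial (Fin 2) ℚ) Fab (C r) = (r : Fab) := by
        rw [← MvPolynomial.algebraMap_eq, ← IsScalarTower.algebraMap_apply]
        simp
      rw [this]
      exact SubfieldClass.ratCast_mem S r
    | add p q hp hq => rw [map_add]; exact S.add_mem hp hq
    | mul_X p n hp =>
      rw [map_mul]
      refine S.mul_mem hp ?_
      fin_cases n
      · exact ha
      · exact hb
  rw [eq_top_iff]
  intro z _
  obtain ⟨p, q, -, rfl⟩ := IsFractionRing.div_surjective (A := MvPolynomial (Fin 2) ℚ) z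
  exact S.div_mem (hpol p) (hpol q)

open IntermediateField in
theorem alg_of_mem (x : Fab) (ht : IsAlgebraic ℚ⟮x⟯ tF) (hb : IsAlgebraic ℚ⟮x⟯ bF) : False := by
  apply not_alg_simple x
  have h := top_of_mem (algebraicClosure ℚ⟮x⟯ Fab).toSubfield
    (mem_algebraicClosure_iff.2 ht) (mem_algebraicClosure_iff.2 hb)
  refine ⟨fun z => ?_⟩
  have : z ∈ (algebraicClosure ℚ⟮x⟯ Fab).toSubfield := by rw [h]; trivial
  exact mem_algebraicClosure_iff.1 this

open IntermediateField in
theorem trans_b : Transcendental ℚ⟮tF⟯ bF := by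
  intro h
  exact alg_of_mem tF (isAlgebraic_algebraMap (⟨tF, mem_adjoin_simple_self _ _⟩ : ℚ⟮tF⟯)) h

open IntermediateField in
theorem trans_t (w s : Fab) (d : ℕ) (hd : 0 < d) (hs : s ∈ ℚ⟮tF⟯) (hs0 : s ≠ 0)
    (hw : w = s * bF ^ d) : Transcendental ℚ⟮w⟯ tF := by
  intro h
  refine alg_of_mem w h ?_
  have hw' : w ∈ algebraicClosure ℚ⟮w⟯ Fab :=
    mem_algebraicClosure_iff.2
      (isAlgebraic_algebraMap (⟨w, mem_adjoin_simple_self _ _⟩ : ℚ⟮w⟯))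
  have ht : tF ∈ (algebraicClosure ℚ⟮w⟯ Fab).restrictScalars ℚ :=
    mem_algebraicClosure_iff.2 h
  have hs' : s ∈ (algebraicClosure ℚ⟮w⟯ Fab).restrictScalars ℚ :=
    (adjoin_simple_le_iff.2 ht) hs
  have : bF ^ d ∈ algebraicClosure ℚ⟮w⟯ Fab := by
    have := div_mem hw' hs'
    have e : w / s = bF ^ d := by rw [hw, mul_div_cancel_left₀ _ hs0]
    rwa [e] at this
  exact IsAlgebraic.of_pow hd (mem_algebraicClosure_iff.1 this)

theorem trans_t0 : Transcendental ℚ tF := by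
  intro h
  exact alg_of_mem bF (h.extendScalars (algebraMap ℚ _).injective)
    (isAlgebraic_algebraMap (⟨bF, IntermediateField.mem_adjoin_simple_self _ _⟩ : IntermediateField.adjoin ℚ {bF}))

section polys
open Polynomial
/-- dehomogenised c4 -/
noncomputable def gam (K : Type*) [Field K] : K[X] :=
  Polynomial.X ^ 20 + 228 * Polynomial.X ^ 15 + 494 * Polynomial.X ^ 10 - 228 * Polynomial.X ^ 5 + 1
/-- dehomogenised D -/
noncomputable def del (K : Type*) [Field K] : K[X] := Polynomial.X * (Polynomial.X ^ 10 - 11 * Polynomial.X ^ 5 - 1)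

theorem cop (K : Type*) [Field K] [CharZero K] : IsCoprime (gam K) (del K) := by
  refine IsCoprime.mul_right ⟨1, -(Polynomial.X ^ 19 + 228 * Polynomial.X ^ 14 + 494 * Polynomial.X ^ 9 - 228 * Polynomial.X ^ 4), ?_⟩ ?_
  · unfold gam; ring
  · have h : Polynomial.C (3125⁻¹ : K) * 3125 = 1 := by
      rw [show (3125 : K[X]) = Polynomial.C 3125 from rfl, ← Polynomial.C_mul]
      simp
    have h2 : IsCoprime (Polynomial.X ^ 10 : K[X]) (Polynomial.X ^ 10 - 11 * Polynomial.X ^ 5 - 1) :=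
      ⟨(Polynomial.X ^ 5 - 11) ^ 2, -(Polynomial.X ^ 10 - 11 * Polynomial.X ^ 5 + 1), by ring⟩
    have h3 : gam K = 3125 * Polynomial.X ^ 10 + (Polynomial.X ^ 10 - 11 * Polynomial.X ^ 5 - 1) * (Polynomial.X ^ 10 + 239 * Polynomial.X ^ 5 - 1) := by
      unfold gam; ring
    rw [h3]
    refine IsCoprime.add_mul_left_left (IsCoprime.mul_left ?_ h2) _
    exact ⟨Polynomial.C (3125⁻¹ : K), 0, by rw [h]; simp⟩

theorem deg_gam (K : Type*) [Field K] : (gam K ^ 3).natDegree = 60 := by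
  rw [natDegree_pow]
  have : (gam K).natDegree = 20 := by unfold gam; compute_degree!
  rw [this]
theorem deg_del (K : Type*) [Field K] : (del K ^ 5).natDegree = 55 := by
  rw [natDegree_pow]
  have : (del K).natDegree = 11 := by unfold del; compute_degree!
  rw [this]
end polys

noncomputable def Dt : Fab := tF * (tF ^ 10 - 11 * tF ^ 5 - 1)
noncomputable def Gt : Fab := tF ^ 20 + 228 * tF ^ 15 + 494 * tF ^ 10 - 228 * tF ^ 5 + 1
noncomputable def Et : Fab :=
  -(tF ^ 30) + 522 * tF ^ 25 + 10005 * tF ^ 20 + 10005 * tF ^ 10 - 522 * tF ^ 5 - 1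
noncomputable def jF : Fab := Gt ^ 3 / Dt ^ 5

theorem num_aeval_11 (K : Type*) [Field K] [Algebra K Fab] :
    Polynomial.aeval tF (11 : Polynomial K) = (11 : Fab) :=
  map_ofNat (Polynomial.aeval tF) 11

theorem num_alg_11 : algebraMap (MvPolynomial (Fin 2) ℚ) Fab 11 = 11 :=
  map_ofNat (algebraMap (MvPolynomial (Fin 2) ℚ) Fab) 11

theorem num_aeval_228 (K : Type*) [Field K] [Algebra K Fab] :
    Polynomial.aeval tF (228 : Polynomial K) = (228 : Fab) :=
  map_ofNat (Polynomial.aeval tF) 228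

theorem num_alg_228 : algebraMap (MvPolynomial (Fin 2) ℚ) Fab 228 = 228 :=
  map_ofNat (algebraMap (MvPolynomial (Fin 2) ℚ) Fab) 228

theorem num_aeval_494 (K : Type*) [Field K] [Algebra K Fab] :
    Polynomial.aeval tF (494 : Polynomial K) = (494 : Fab) :=
  map_ofNat (Polynomial.aeval tF) 494

theorem num_alg_494 : algebraMap (MvPolynomial (Fin 2) ℚ) Fab 494 = 494 :=
  map_ofNat (algebraMap (MvPolynomial (Fin 2) ℚ) Fab) 494

theorem num_aeval_522 (K : Type*) [Field K] [Algebra K Fab] :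
    Polynomial.aeval tF (522 : Polynomial K) = (522 : Fab) :=
  map_ofNat (Polynomial.aeval tF) 522

theorem num_alg_522 : algebraMap (MvPolynomial (Fin 2) ℚ) Fab 522 = 522 :=
  map_ofNat (algebraMap (MvPolynomial (Fin 2) ℚ) Fab) 522

theorem num_aeval_10005 (K : Type*) [Field K] [Algebra K Fab] :
    Polynomial.aeval tF (10005 : Polynomial K) = (10005 : Fab) :=
  map_ofNat (Polynomial.aeval tF) 10005

theorem num_alg_10005 : algebraMap (MvPolynomial (Fin 2) ℚ) Fab 10005 = 10005 :=
  map_ofNat (algebraMap (MvPolynomial (Fin 2) ℚ) Fab) 10005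

theorem aeval_gam (K : Type*) [Field K] [Algebra K Fab] :
    Polynomial.aeval tF (gam K) = Gt := by
  simp [gam, Gt, num_aeval_11, num_aeval_228, num_aeval_494, num_aeval_522, num_aeval_10005]

theorem aeval_del (K : Type*) [Field K] [Algebra K Fab] :
    Polynomial.aeval tF (del K) = Dt := by
  simp [del, Dt, num_aeval_11, num_aeval_228, num_aeval_494, num_aeval_522, num_aeval_10005]

theorem aeval_ne (p : Polynomial ℚ) (r : ℚ) (h : p.eval r ≠ 0) : Polynomial.aeval tF p ≠ 0 := by
  intro h0
  have := (transcendental_iff.1 trans_t0) p h0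
  rw [this] at h
  simp at h

theorem Gt_ne : Gt ≠ 0 := by
  rw [← aeval_gam ℚ]
  exact aeval_ne _ 0 (by simp [gam])
theorem Dt_ne : Dt ≠ 0 := by
  rw [← aeval_del ℚ]
  exact aeval_ne _ 1 (by norm_num [del])
theorem Et_ne : Et ≠ 0 := by
  have := aeval_ne (-(Polynomial.X ^ 30) + 522 * Polynomial.X ^ 25 + 10005 * Polynomial.X ^ 20
    + 10005 * Polynomial.X ^ 10 - 522 * Polynomial.X ^ 5 - 1) 0 (by simp)
  simpa [Et, num_aeval_11, num_aeval_228, num_aeval_494, num_aeval_522, num_aeval_10005] using this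

theorem tF_mul : tF * bF = aF := div_mul_cancel₀ _ bF_ne

theorem DF_eq : DF = bF ^ 12 * Dt := by
  have : DF = aF * bF * (aF ^ 10 - 11 * aF ^ 5 * bF ^ 5 - bF ^ 10) := by
    simp [DF, aF, bF, num_alg_11, num_alg_228, num_alg_494, num_alg_522, num_alg_10005]
  rw [this, ← tF_mul, Dt]; ring
theorem c4F_eq : c4F = bF ^ 20 * Gt := by
  have : c4F = aF ^ 20 + 228 * aF ^ 15 * bF ^ 5 + 494 * aF ^ 10 * bF ^ 10
      - 228 * aF ^ 5 * bF ^ 15 + bF ^ 20 := by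
    simp [c4F, aF, bF, num_alg_11, num_alg_228, num_alg_494, num_alg_522, num_alg_10005]
  rw [this, ← tF_mul, Gt]; ring
theorem c6F_eq : c6F = bF ^ 30 * Et := by
  have : c6F = -(aF ^ 30) + 522 * aF ^ 25 * bF ^ 5 + 10005 * aF ^ 20 * bF ^ 10
      + 10005 * aF ^ 10 * bF ^ 20 - 522 * aF ^ 5 * bF ^ 25 - bF ^ 30 := by
    simp [c6F, aF, bF, num_alg_11, num_alg_228, num_alg_494, num_alg_522, num_alg_10005]
  rw [this, ← tF_mul, Et]; ring

theorem syzygy : Gt ^ 3 - Et ^ 2 = 1728 * Dt ^ 5 := by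
  unfold Gt Et Dt; ring

theorem DF_ne : DF ≠ 0 := by rw [DF_eq]; exact mul_ne_zero (pow_ne_zero _ bF_ne) Dt_ne
theorem c4F_ne : c4F ≠ 0 := by rw [c4F_eq]; exact mul_ne_zero (pow_ne_zero _ bF_ne) Gt_ne
theorem c6F_ne : c6F ≠ 0 := by rw [c6F_eq]; exact mul_ne_zero (pow_ne_zero _ bF_ne) Et_ne
theorem syzygyF : c4F ^ 3 - c6F ^ 2 = 1728 * DF ^ 5 := by
  rw [DF_eq, c4F_eq, c6F_eq]
  linear_combination bF ^ 60 * syzygy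
theorem jF_eq : jF = c4F ^ 3 / DF ^ 5 := by
  rw [DF_eq, c4F_eq, jF]
  have := bF_ne
  have := Dt_ne
  field_simp

theorem closure_eq_adjoin (S : Set Fab) :
    Subfield.closure S = (IntermediateField.adjoin ℚ S).toSubfield := by
  apply le_antisymm
  · rw [Subfield.closure_le]
    exact IntermediateField.subset_adjoin ℚ S
  · rw [IntermediateField.adjoin_toSubfield, Subfield.closure_le]
    rintro x (⟨r, rfl⟩ | hx)
    · rw [eq_ratCast]
      exact SubfieldClass.ratCast_mem _ r
    · exact Subfield.subset_closure hx

open IntermediateField in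
theorem main_deg (f g w s : Fab) (d : ℕ) (hd : 0 < d) (hs : s ∈ ℚ⟮tF⟯) (hs0 : s ≠ 0)
    (hw : w = s * bF ^ d)
    (hwm : w ∈ Subfield.closure {f, g}) (hjm : jF ∈ Subfield.closure {f, g})
    (hfm : ∀ S : Subfield Fab, w ∈ S → jF ∈ S → f ∈ S ∧ g ∈ S) :
    FiniteDimensional ↥(Subfield.closure ({f, g} : Set Fab)) Fab ∧
      Module.finrank ↥(Subfield.closure ({f, g} : Set Fab)) Fab = 60 * d := by
  have hcl : Subfield.closure ({f, g} : Set Fab) = (adjoin ℚ {w, jF}).toSubfield := by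
    rw [← closure_eq_adjoin]
    apply le_antisymm
    · rw [Subfield.closure_le]
      have := hfm (Subfield.closure {w, jF}) (Subfield.subset_closure (by simp))
        (Subfield.subset_closure (by simp))
      rintro x (rfl | rfl)
      exacts [this.1, this.2]
    · rw [Subfield.closure_le]
      rintro x (rfl | rfl)
      exacts [hwm, hjm]
  have tt := trans_t w s d hd hs hs0 hw
  have r1 : relfinrank (ℚ⟮w⟯)⟮jF⟯ (ℚ⟮w⟯)⟮tF⟯ = 60 := by
    rw [luroth_relfinrank tF jF tt (gam _ ^ 3) (del _ ^ 5) (cop _).pow ?_ ?_, deg_gam, deg_del]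
    · rfl
    · intro h
      have := deg_del ℚ⟮w⟯
      rw [h] at this
      simp at this
    · rw [map_pow, map_pow, aeval_gam, aeval_del, jF]
  have hs1 : (Polynomial.C (⟨s, hs⟩ : ℚ⟮tF⟯)) ≠ 0 := by
    rw [Ne, Polynomial.C_eq_zero]
    intro h
    exact hs0 (congrArg Subtype.val h)
  have r2 : relfinrank (ℚ⟮tF⟯)⟮w⟯ (ℚ⟮tF⟯)⟮bF⟯ = d := by
    rw [luroth_relfinrank bF w trans_b (Polynomial.C (⟨s, hs⟩ : ℚ⟮tF⟯) * Polynomial.X ^ d) 1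
      isCoprime_one_right one_ne_zero ?_]
    · rw [Polynomial.natDegree_C_mul_X_pow d _ (by simpa using hs1)]
      simp
    · rw [hw]
      simp
  have r1' : Subfield.relfinrank (adjoin ℚ {w, jF}).toSubfield (adjoin ℚ {w, tF}).toSubfield
      = 60 := by
    rw [← adjoin_simple_adjoin_simple, ← adjoin_simple_adjoin_simple]
    exact r1
  have r2' : Subfield.relfinrank (adjoin ℚ {w, tF}).toSubfield ⊤ = d := by
    have e : (⊤ : Subfield Fab) = (adjoin ℚ {tF, bF}).toSubfield :=
      (top_of_mem _ (subset_adjoin ℚ _ (by simp)) (subset_adjoin ℚ _ (by simp))).symm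
    rw [e, Set.pair_comm w tF, ← adjoin_simple_adjoin_simple, ← adjoin_simple_adjoin_simple]
    exact r2
  have hle : (adjoin ℚ {w, jF}).toSubfield ≤ (adjoin ℚ {w, tF}).toSubfield := by
    rw [← closure_eq_adjoin, ← closure_eq_adjoin, Subfield.closure_le]
    have ht : tF ∈ Subfield.closure {w, tF} := Subfield.subset_closure (by simp)
    rintro x (rfl | rfl)
    · exact Subfield.subset_closure (by simp)
    · have : ∀ n : ℕ, (n : Fab) ∈ Subfield.closure {w, tF} := fun n => natCast_mem _ n
      have h228 : (228 : Fab) ∈ Subfield.closure {w, tF} := by exact_mod_cast this 228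
      have h494 : (494 : Fab) ∈ Subfield.closure {w, tF} := by exact_mod_cast this 494
      have h11 : (11 : Fab) ∈ Subfield.closure {w, tF} := by exact_mod_cast this 11
      have hp : ∀ n : ℕ, tF ^ n ∈ Subfield.closure {w, tF} := fun n => pow_mem ht n
      refine div_mem (pow_mem ?_ _) (pow_mem ?_ _)
      · exact add_mem (sub_mem (add_mem (add_mem (hp _) (mul_mem h228 (hp _)))
          (mul_mem h494 (hp _))) (mul_mem h228 (hp _))) (one_mem _)
      · exact mul_mem ht (sub_mem (sub_mem (hp _) (mul_mem h11 (hp _))) (one_mem _))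
  have fin : Module.finrank ↥(Subfield.closure ({f, g} : Set Fab)) Fab = 60 * d := by
    rw [hcl, ← Subfield.relfinrank_top_right, ← Subfield.relfinrank_mul_relfinrank hle le_top,
      r1', r2']
  refine ⟨FiniteDimensional.of_finrank_pos ?_, fin⟩
  rw [fin]; omega

theorem Dt_mem : Dt ∈ IntermediateField.adjoin ℚ {tF} := by
  rw [← aeval_del ℚ]
  exact IntermediateField.algebra_adjoin_le_adjoin ℚ _ (Polynomial.aeval_mem_adjoin_singleton _ _)
theorem Gt_mem : Gt ∈ IntermediateField.adjoin ℚ {tF} := by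
  rw [← aeval_gam ℚ]
  exact IntermediateField.algebra_adjoin_le_adjoin ℚ _ (Polynomial.aeval_mem_adjoin_singleton _ _)
theorem Et_mem : Et ∈ IntermediateField.adjoin ℚ {tF} := by
  have : Et = Polynomial.aeval tF (-(Polynomial.X ^ 30) + 522 * Polynomial.X ^ 25
    + 10005 * Polynomial.X ^ 20
    + 10005 * Polynomial.X ^ 10 - 522 * Polynomial.X ^ 5 - 1 : Polynomial ℚ) := by simp [Et, num_aeval_11, num_aeval_228, num_aeval_494, num_aeval_522, num_aeval_10005]
  rw [this]
  exact IntermediateField.algebra_adjoin_le_adjoin ℚ _ (Polynomial.aeval_mem_adjoin_singleton _ _)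

theorem mem1728 (S : Subfield Fab) : (1728 : Fab) ∈ S := by
  exact_mod_cast natCast_mem S 1728

/-- `ℚ(a,b)` has degree `600` over `ℚ(c4, c6)`, degree `240` over `ℚ(D, c4)`,
and degree `360` over `ℚ(D, c6)`. -/
theorem degrees_over_invariant_subfields :
    (FiniteDimensional ↥(Subfield.closure ({c4F, c6F} : Set Fab)) Fab ∧
      Module.finrank ↥(Subfield.closure ({c4F, c6F} : Set Fab)) Fab = 600) ∧
    (FiniteDimensional ↥(Subfield.closure ({DF, c4F} : Set Fab)) Fab ∧
      Module.finrank ↥(Subfield.closure ({DF, c4F} : Set Fab)) Fab = 240) ∧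
    (FiniteDimensional ↥(Subfield.closure ({DF, c6F} : Set Fab)) Fab ∧
      Module.finrank ↥(Subfield.closure ({DF, c6F} : Set Fab)) Fab = 360) := by
  have hb := bF_ne
  have hD := Dt_ne
  have hG := Gt_ne
  have hE := Et_ne
  have hDF := DF_ne
  have h4 := c4F_ne
  have h6 := c6F_ne
  have hsyz := syzygyF
  refine ⟨?_, ?_, ?_⟩
  · refine main_deg c4F c6F (c6F / c4F) (Et / Gt) 10 (by norm_num) (div_mem Et_mem Gt_mem)
      (div_ne_zero hE hG) ?_ ?_ ?_ ?_
    · rw [c6F_eq, c4F_eq]; field_simp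
    · exact div_mem (Subfield.subset_closure (by simp)) (Subfield.subset_closure (by simp))
    · have m4 : c4F ∈ Subfield.closure {c4F, c6F} := Subfield.subset_closure (by simp)
      have m6 : c6F ∈ Subfield.closure {c4F, c6F} := Subfield.subset_closure (by simp)
      have : jF = c4F ^ 3 / ((c4F ^ 3 - c6F ^ 2) / 1728) := by
        rw [hsyz, jF_eq]; field_simp
      rw [this]
      exact div_mem (pow_mem m4 _) (div_mem (sub_mem (pow_mem m4 _) (pow_mem m6 _)) (mem1728 _))
    · intro S hw hj
      have hr : c6F ^ 2 / c4F ^ 3 ∈ S := by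
        have : c6F ^ 2 / c4F ^ 3 = 1 - 1728 / jF := by
          rw [jF_eq]; field_simp; linear_combination -hsyz
        rw [this]
        exact sub_mem (one_mem _) (div_mem (mem1728 _) hj)
      have e4 : c4F = (c6F / c4F) ^ 2 / (c6F ^ 2 / c4F ^ 3) := by field_simp
      have m4 : c4F ∈ S := by rw [e4]; exact div_mem (pow_mem hw _) hr
      refine ⟨m4, ?_⟩
      have := mul_mem hw m4
      rwa [div_mul_cancel₀ _ h4] at this
  · refine main_deg DF c4F (c4F ^ 2 / DF ^ 3) (Gt ^ 2 / Dt ^ 3) 4 (by norm_num)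
      (div_mem (pow_mem Gt_mem _) (pow_mem Dt_mem _))
      (div_ne_zero (pow_ne_zero _ hG) (pow_ne_zero _ hD)) ?_ ?_ ?_ ?_
    · rw [DF_eq, c4F_eq]; field_simp
    · exact div_mem (pow_mem (Subfield.subset_closure (by simp)) _)
        (pow_mem (Subfield.subset_closure (by simp)) _)
    · rw [jF_eq]
      exact div_mem (pow_mem (Subfield.subset_closure (by simp)) _)
        (pow_mem (Subfield.subset_closure (by simp)) _)
    · intro S hw hj
      have eD : DF = (c4F ^ 2 / DF ^ 3) ^ 3 / jF ^ 2 := by rw [jF_eq]; field_simp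
      have mD : DF ∈ S := by rw [eD]; exact div_mem (pow_mem hw _) (pow_mem hj _)
      refine ⟨mD, ?_⟩
      have e4 : c4F = jF * DF ^ 2 / (c4F ^ 2 / DF ^ 3) := by rw [jF_eq]; field_simp
      rw [e4]
      exact div_mem (mul_mem hj (pow_mem mD _)) hw
  · refine main_deg DF c6F (c6F / DF ^ 2) (Et / Dt ^ 2) 6 (by norm_num)
      (div_mem Et_mem (pow_mem Dt_mem _))
      (div_ne_zero hE (pow_ne_zero _ hD)) ?_ ?_ ?_ ?_
    · rw [DF_eq, c6F_eq]; field_simp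
    · exact div_mem (Subfield.subset_closure (by simp))
        (pow_mem (Subfield.subset_closure (by simp)) _)
    · have : jF = c6F ^ 2 / DF ^ 5 + 1728 := by
        rw [jF_eq]; field_simp; linear_combination hsyz
      rw [this]
      exact add_mem (div_mem (pow_mem (Subfield.subset_closure (by simp)) _)
        (pow_mem (Subfield.subset_closure (by simp)) _)) (mem1728 _)
    · intro S hw hj
      have e1 : c6F ^ 2 / DF ^ 5 = jF - 1728 := by
        rw [jF_eq]; field_simp; linear_combination -hsyz
      have m1 : c6F ^ 2 / DF ^ 5 ∈ S := by rw [e1]; exact sub_mem hj (mem1728 _)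
      have eD : DF = (c6F / DF ^ 2) ^ 2 / (c6F ^ 2 / DF ^ 5) := by field_simp
      have mD : DF ∈ S := by rw [eD]; exact div_mem (pow_mem hw _) m1
      refine ⟨mD, ?_⟩
      have e6 : c6F = (c6F / DF ^ 2) * DF ^ 2 := by field_simp
      rw [e6]
      exact mul_mem hw (pow_mem mD _)
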